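/- arXiv:2506.06663 — 3 statements merged into one kernel-verified Lean document; each statement's English description precedes it below -/
import Mathlib

section
/- Let m be a positive integer and a an integer with a > m. Then ∑_{k=1}^{m} ψ₀(a+1-k)/k = -∑_{k=1}^{m} ψ₀(k+a-m)/k + (1/2)·( -2ψ₀(a+1)·(ψ₀(a-m) - ψ₀(m+1) + ψ₀(1)) + (ψ₀(a-m) + 2ψ₀(m+1) - 2ψ₀(1))·ψ₀(a-m) - ψ₁(a-m) + ψ₀²(a+1) + ψ₁(a+1) ). -/
open Finset

/-- Digamma function at a positive integer argument: `ψ₀ l = -γ + ∑_{i=1}^{l-1} 1/i`. -/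
noncomputable def ψ₀ (l : ℕ) : ℝ :=
  -Real.eulerMascheroniConstant + ∑ i ∈ Finset.range (l - 1), (1 : ℝ) / (i + 1)

/-- Trigamma function at a positive integer argument: `ψ₁ l = π²/6 - ∑_{i=1}^{l-1} 1/i²`. -/
noncomputable def ψ₁ (l : ℕ) : ℝ :=
  Real.pi ^ 2 / 6 - ∑ i ∈ Finset.range (l - 1), (1 : ℝ) / (i + 1) ^ 2

/-- Tetragamma function at a positive integer argument:
`ψ₂ l = -2ζ(3) + 2∑_{i=1}^{l-1} 1/i³`, where `ζ(3) = ∑_{i=1}^∞ 1/i³`. -/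
noncomputable def ψ₂ (l : ℕ) : ℝ :=
  -2 * (∑' i : ℕ, (1 : ℝ) / (i + 1) ^ 3) +
    2 * ∑ i ∈ Finset.range (l - 1), (1 : ℝ) / (i + 1) ^ 3


lemma psi0_succ (l : ℕ) : ψ₀ (l + 2) = ψ₀ (l + 1) + 1 / ((l : ℝ) + 1) := by
  simp only [ψ₀, show l + 2 - 1 = l + 1 by omega, show l + 1 - 1 = l by omega,
    Finset.sum_range_succ]
  ring

lemma psi1_succ (l : ℕ) : ψ₁ (l + 2) = ψ₁ (l + 1) - (1 / ((l : ℝ) + 1)) ^ 2 := by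
  rw [one_div_pow]
  simp only [ψ₁, show l + 2 - 1 = l + 1 by omega, show l + 1 - 1 = l by omega,
    Finset.sum_range_succ]
  ring

lemma harm_sum (m : ℕ) : ∑ k ∈ range m, 1 / ((k : ℝ) + 1) = ψ₀ (m + 1) - ψ₀ 1 := by
  simp [ψ₀]

lemma harm_sum_refl (c m : ℕ) :
    ∑ k ∈ range m, 1 / (((c + (m - 1 - k) : ℕ) : ℝ) + 2) = ψ₀ (c + m + 2) - ψ₀ (c + 2) := by
  rw [Finset.sum_range_reflect (fun j => 1 / (((c + j : ℕ) : ℝ) + 2)) m]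
  induction m with
  | zero => simp
  | succ m ih =>
    rw [Finset.sum_range_succ, ih, show c + (m + 1) + 2 = (c + m + 1) + 2 by ring,
      psi0_succ (c + m + 1)]
    push_cast
    ring

lemma first_step (c m : ℕ) :
    ∑ k ∈ range (m + 1), ψ₀ (c + (m + 1 - 1 - k) + 2) / ((k : ℝ) + 1) =
      ∑ k ∈ range m, ψ₀ (c + (m - 1 - k) + 2) / ((k : ℝ) + 1) +
      1 / ((c : ℝ) + m + 2) * (ψ₀ (m + 1) - ψ₀ 1 + (ψ₀ (c + m + 2) - ψ₀ (c + 2))) +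
      ψ₀ (c + 2) / ((m : ℝ) + 1) := by
  rw [Finset.sum_range_succ, ← harm_sum, ← harm_sum_refl, ← Finset.sum_add_distrib,
    Finset.mul_sum, ← Finset.sum_add_distrib]
  congr 1
  · refine Finset.sum_congr rfl fun k hk => ?_
    obtain ⟨j, rfl⟩ : ∃ j, m = k + 1 + j := ⟨m - (k + 1), by have := mem_range.1 hk; omega⟩
    rw [show k + 1 + j + 1 - 1 - k = j + 1 by omega, show k + 1 + j - 1 - k = j by omega,
      show c + (j + 1) + 2 = (c + j + 1) + 2 by ring, psi0_succ]
    have h1 : (k : ℝ) + 1 ≠ 0 := by positivity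
    have h2 : (c : ℝ) + j + 2 ≠ 0 := by positivity
    have h3 : (c : ℝ) + (k + 1 + j) + 2 ≠ 0 := by positivity
    have h4 : (c : ℝ) + j + 1 + 1 ≠ 0 := by positivity
    push_cast
    field_simp
    ring
  · simp

lemma main_aux (c m : ℕ) :
    ∑ k ∈ range m, ψ₀ (c + (m - 1 - k) + 2) / ((k : ℝ) + 1) =
      -∑ k ∈ range m, ψ₀ (c + k + 2) / ((k : ℝ) + 1) +
        (1 / 2) * (-2 * ψ₀ (c + m + 2) * (ψ₀ (c + 1) - ψ₀ (m + 1) + ψ₀ 1) +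
          (ψ₀ (c + 1) + 2 * ψ₀ (m + 1) - 2 * ψ₀ 1) * ψ₀ (c + 1) -
          ψ₁ (c + 1) + ψ₀ (c + m + 2) ^ 2 + ψ₁ (c + m + 2)) := by
  induction m with
  | zero =>
    simp only [Finset.range_zero, Finset.sum_empty, add_zero, zero_add]
    rw [psi0_succ, psi1_succ]
    ring
  | succ m ih =>
    rw [first_step, ih, Finset.sum_range_succ]
    rw [show c + (m + 1) + 2 = (c + m + 1) + 2 by ring, psi0_succ (c + m + 1),
      psi1_succ (c + m + 1), psi0_succ m, psi0_succ c, show c + m + 1 + 1 = c + m + 2 by ring]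
    have h1 : (c : ℝ) + 1 ≠ 0 := by positivity
    have h2 : (m : ℝ) + 1 ≠ 0 := by positivity
    have h3 : (c : ℝ) + m + 2 ≠ 0 := by positivity
    have h4 : ((c + m + 1 : ℕ) : ℝ) + 1 = c + m + 2 := by push_cast; ring
    have key : 1 / ((c : ℝ) + m + 2) * (1 / ((m : ℝ) + 1)) =
        1 / ((m : ℝ) + 1) * (1 / ((c : ℝ) + 1)) - 1 / ((c : ℝ) + m + 2) * (1 / ((c : ℝ) + 1)) := by
      field_simp
      ring
    rw [h4]
    simp only [div_eq_mul_one_div (ψ₀ _) _, div_eq_mul_one_div (ψ₀ _ + _) _]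
    generalize 1 / ((c : ℝ) + m + 2) = d at *
    generalize 1 / ((m : ℝ) + 1) = e at *
    generalize 1 / ((c : ℝ) + 1) = f at *
    linear_combination -key

theorem stmt2 (m a : ℕ) (hm : 0 < m) (ha : m < a) :
    ∑ k ∈ Finset.Icc 1 m, ψ₀ (a + 1 - k) / (k : ℝ) =
      -∑ k ∈ Finset.Icc 1 m, ψ₀ (k + a - m) / (k : ℝ) +
        (1 / 2) * (-2 * ψ₀ (a + 1) * (ψ₀ (a - m) - ψ₀ (m + 1) + ψ₀ 1) +
          (ψ₀ (a - m) + 2 * ψ₀ (m + 1) - 2 * ψ₀ 1) * ψ₀ (a - m) -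
          ψ₁ (a - m) + ψ₀ (a + 1) ^ 2 + ψ₁ (a + 1)) := by
  obtain ⟨c, rfl⟩ : ∃ c, a = c + m + 1 := ⟨a - (m + 1), by omega⟩
  have hI : ∀ f : ℕ → ℝ, ∑ k ∈ Finset.Icc 1 m, f k = ∑ k ∈ range m, f (k + 1) := by
    intro f
    rw [Finset.range_eq_Ico, Finset.sum_Ico_add' f 0 m 1]
    rfl
  rw [hI, hI, show c + m + 1 - m = c + 1 by omega, show c + m + 1 + 1 = c + m + 2 by ring]
  have h := main_aux c m
  have e1 : ∑ k ∈ range m, ψ₀ (c + m + 2 - (k + 1)) / ((k + 1 : ℕ) : ℝ) =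
      ∑ k ∈ range m, ψ₀ (c + (m - 1 - k) + 2) / ((k : ℝ) + 1) := by
    refine Finset.sum_congr rfl fun k hk => ?_
    have := mem_range.1 hk
    rw [show c + m + 2 - (k + 1) = c + (m - 1 - k) + 2 by omega]
    push_cast
    rfl
  have e2 : ∑ k ∈ range m, ψ₀ (k + 1 + (c + m + 1) - m) / ((k + 1 : ℕ) : ℝ) =
      ∑ k ∈ range m, ψ₀ (c + k + 2) / ((k : ℝ) + 1) := by
    refine Finset.sum_congr rfl fun k hk => ?_
    rw [show k + 1 + (c + m + 1) - m = c + k + 2 by omega]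
    push_cast
    rfl
  rw [e1, e2]
  exact h
end

section
/- Let m be a positive integer and a an integer with a > m. Then ∑_{k=1}^{m} ψ₀(k)·ψ₀(k+a-m)/(m+1-k) = (1/2)·∑_{k=1}^{m} ( ψ₀²(a+1-k)/k + ψ₀²(k+a-m)/k + ψ₀²(k)/(k+a-m) + ψ₁(k)/(k+a-m) ) + (1/(a-m))·∑_{k=1}^{m} ψ₀(k+a-m)/k + (1/(2(a-m)²))·(ψ₀(a-m+1) - ψ₀(a+1) + ψ₀(m+1) - ψ₀(1)) + (1/(2(a-m)))·(ψ₀²(a-m+1) - ψ₀²(a+1)) + (1/12)·( 6ψ₀²(a+1)·(ψ₀(a-m+1) + ψ₀(1)) + 6ψ₀(a+1)·( -2ψ₀(m+1)·(ψ₀(a-m+1) + ψ₀(1)) + ψ₁(a-m+1) - ψ₁(a+1) + ψ₀²(m+1) + ψ₁(m+1) - 2ψ₁(1) ) - 2ψ₀³(a-m+1) + 6ψ₀(1)·ψ₀²(a-m+1) + 6ψ₀(m+1)·(ψ₁(a+1) - ψ₁(a-m+1)) + 6·(ψ₀²(m+1) + ψ₁(m+1))·ψ₀(a-m+1) + ψ₂(a-m+1)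 - 4ψ₀³(a+1) - ψ₂(a+1) ). -/
open Finset

/-- Recurrence for convolutions with `1/j`. -/
lemma conv_succ (u : ℕ → ℝ) (m : ℕ) :
    ∑ i ∈ range (m + 1), u i / (((m + 1 : ℕ) : ℝ) - i) =
      ∑ i ∈ range m, u i / ((m : ℝ) - i) +
        ∑ i ∈ range m, (u (i + 1) - u i) / ((m : ℝ) - i) + u 0 / ((m : ℝ) + 1) := by
  rw [Finset.sum_range_succ', ← Finset.sum_add_distrib]
  congr 1
  · apply Finset.sum_congr rfl
    intro i _
    push_cast
    rw [show (m : ℝ) + 1 - (i + 1) = m - i by ring]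
    ring
  · push_cast
    simp

lemma F_shift (F : ℕ → ℝ) (hF : ∀ n : ℕ, F (n + 1) = F n + 1 / ((n : ℝ) + 1)) (n d : ℕ) :
    F (n + 1 + d) = F (n + d) + 1 / ((n : ℝ) + 1 + d) := by
  rw [show n + 1 + d = (n + d) + 1 by ring, hF]; push_cast; ring

lemma G_shift (G : ℕ → ℝ) (hG : ∀ n : ℕ, G (n + 1) = G n - 1 / ((n : ℝ) + 1) ^ 2) (n d : ℕ) :
    G (n + 1 + d) = G (n + d) - 1 / ((n : ℝ) + 1 + d) ^ 2 := by
  rw [show n + 1 + d = (n + d) + 1 by ring, hG]; push_cast; ring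

lemma K_shift (K : ℕ → ℝ) (hK : ∀ n : ℕ, K (n + 1) = K n + 2 / ((n : ℝ) + 1) ^ 3) (n d : ℕ) :
    K (n + 1 + d) = K (n + d) + 2 / ((n : ℝ) + 1 + d) ^ 3 := by
  rw [show n + 1 + d = (n + d) + 1 by ring, hK]; push_cast; ring

lemma sum_inv_shift (F : ℕ → ℝ) (hF : ∀ n : ℕ, F (n + 1) = F n + 1 / ((n : ℝ) + 1)) (m d : ℕ) :
    ∑ i ∈ range m, 1 / ((i : ℝ) + 1 + d) = F (m + d) - F d := by
  induction m with
  | zero => simp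
  | succ m ih => rw [Finset.sum_range_succ, ih, F_shift F hF]; ring

lemma sum_inv (F : ℕ → ℝ) (hF : ∀ n : ℕ, F (n + 1) = F n + 1 / ((n : ℝ) + 1)) (m : ℕ) :
    ∑ i ∈ range m, 1 / ((i : ℝ) + 1) = F m - F 0 := by
  simpa using sum_inv_shift F hF m 0

lemma sum_inv_refl (F : ℕ → ℝ) (hF : ∀ n : ℕ, F (n + 1) = F n + 1 / ((n : ℝ) + 1)) (m : ℕ) :
    ∑ i ∈ range m, 1 / ((m : ℝ) - i) = F m - F 0 := by
  induction m with
  | zero => simp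
  | succ m ih => rw [conv_succ (fun _ => 1), ih, hF]; simp; ring

lemma cast_sub_ne {m i : ℕ} (h : i ∈ range m) : (m : ℝ) - i ≠ 0 := by
  have : (i : ℝ) < m := by exact_mod_cast Finset.mem_range.mp h
  exact ne_of_gt (sub_pos.mpr this)

/-- `T2` in closed form. -/
lemma T2_closed (F G : ℕ → ℝ) (hF : ∀ n : ℕ, F (n + 1) = F n + 1 / ((n : ℝ) + 1))
    (hG : ∀ n : ℕ, G (n + 1) = G n - 1 / ((n : ℝ) + 1) ^ 2) (m : ℕ) :
    ∑ i ∈ range m, F i / ((m : ℝ) - i) =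
      F 0 * (F m - F 0) + (F m - F 0) ^ 2 - (G 0 - G m) := by
  induction m with
  | zero => simp
  | succ m ih =>
    have e : ∑ i ∈ range m, (F (i + 1) - F i) / ((m : ℝ) - i) =
        1 / ((m : ℝ) + 1) * (∑ i ∈ range m, 1 / ((i : ℝ) + 1) +
          ∑ i ∈ range m, 1 / ((m : ℝ) - i)) := by
      rw [← Finset.sum_add_distrib, Finset.mul_sum]
      apply Finset.sum_congr rfl
      intro i hi
      have h1 := cast_sub_ne hi
      have h2 : (i : ℝ) + 1 ≠ 0 := by positivity
      have h3 : (m : ℝ) + 1 ≠ 0 := by positivity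
      rw [hF]
      field_simp
      ring
    rw [conv_succ F, e, ih, sum_inv F hF, sum_inv_refl F hF, hF, hG]
    have h3 : (m : ℝ) + 1 ≠ 0 := by positivity
    field_simp
    ring

/-- `T4` in terms of `T1`. -/
lemma T4_closed (F G : ℕ → ℝ) (hF : ∀ n : ℕ, F (n + 1) = F n + 1 / ((n : ℝ) + 1))
    (hG : ∀ n : ℕ, G (n + 1) = G n - 1 / ((n : ℝ) + 1) ^ 2) (m d : ℕ) :
    ∑ i ∈ range m, F (i + d) / ((m : ℝ) - i) =
      ∑ i ∈ range m, F i / ((i : ℝ) + 1 + d) +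
      (1 / 2) * (F (m + d) ^ 2 - F d ^ 2 - (G d - G (m + d))) -
      (F d + F 0) * (F (m + d) - F d) + F d * (F m - F 0) := by
  induction m with
  | zero => simp
  | succ m ih =>
    have e : ∑ i ∈ range m, (F (i + 1 + d) - F (i + d)) / ((m : ℝ) - i) =
        1 / ((m : ℝ) + 1 + d) * (∑ i ∈ range m, 1 / ((i : ℝ) + 1 + d) +
          ∑ i ∈ range m, 1 / ((m : ℝ) - i)) := by
      rw [← Finset.sum_add_distrib, Finset.mul_sum]
      apply Finset.sum_congr rfl
      intro i hi
      have h1 := cast_sub_ne hi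
      have h2 : (i : ℝ) + 1 + d ≠ 0 := by positivity
      have h3 : (m : ℝ) + 1 + d ≠ 0 := by positivity
      rw [F_shift F hF]
      field_simp
      ring
    rw [conv_succ (fun i => F (i + d)), e, ih, sum_inv_shift F hF, sum_inv_refl F hF,
      F_shift F hF, G_shift G hG, hF, Finset.sum_range_succ, zero_add]
    have h3 : (m : ℝ) + 1 ≠ 0 := by positivity
    have h4 : (m : ℝ) + 1 + d ≠ 0 := by positivity
    field_simp
    ring

/-- `T1 + T3` by summation by parts. -/
lemma T13 (F : ℕ → ℝ) (hF : ∀ n : ℕ, F (n + 1) = F n + 1 / ((n : ℝ) + 1)) (m d : ℕ)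
    (hd : 0 < d) :
    ∑ i ∈ range m, F (i + d) / ((i : ℝ) + 1) =
      F m * F (m + d) - F 0 * F d - 1 / (d : ℝ) * ((F m - F 0) - (F (m + d) - F d)) -
      ∑ i ∈ range m, F i / ((i : ℝ) + 1 + d) := by
  induction m with
  | zero => simp
  | succ m ih =>
    rw [Finset.sum_range_succ, Finset.sum_range_succ, ih, F_shift F hF, hF]
    have h3 : (m : ℝ) + 1 ≠ 0 := by positivity
    have h4 : (m : ℝ) + 1 + d ≠ 0 := by positivity
    have h5 : (d : ℝ) ≠ 0 := by positivity
    field_simp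
    ring

lemma S1_succ (F : ℕ → ℝ) (hF : ∀ n : ℕ, F (n + 1) = F n + 1 / ((n : ℝ) + 1)) (m d : ℕ)
    (hd : 0 < d) :
    ∑ i ∈ range (m + 1), F i * F (i + d) / (((m + 1 : ℕ) : ℝ) - i) =
      ∑ i ∈ range m, F i * F (i + d) / ((m : ℝ) - i) +
      (1 / ((m : ℝ) + 1 + d) * (∑ i ∈ range m, F i / ((i : ℝ) + 1 + d) +
          ∑ i ∈ range m, F i / ((m : ℝ) - i)) +
        1 / ((m : ℝ) + 1) * (∑ i ∈ range m, F (i + d) / ((i : ℝ) + 1) +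
          ∑ i ∈ range m, F (i + d) / ((m : ℝ) - i)) +
        1 / (d : ℝ) * (1 / ((m : ℝ) + 1) * (2 * (F m - F 0)) -
          1 / ((m : ℝ) + 1 + d) * ((F (m + d) - F d) + (F m - F 0)))) +
      F 0 * F d / ((m : ℝ) + 1) := by
  have e : ∑ i ∈ range m, (F (i + 1) * F (i + 1 + d) - F i * F (i + d)) / ((m : ℝ) - i) =
      1 / ((m : ℝ) + 1 + d) * (∑ i ∈ range m, F i / ((i : ℝ) + 1 + d) +
          ∑ i ∈ range m, F i / ((m : ℝ) - i)) +
        1 / ((m : ℝ) + 1) * (∑ i ∈ range m, F (i + d) / ((i : ℝ) + 1) +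
          ∑ i ∈ range m, F (i + d) / ((m : ℝ) - i)) +
        1 / (d : ℝ) * (1 / ((m : ℝ) + 1) * (∑ i ∈ range m, 1 / ((i : ℝ) + 1) +
            ∑ i ∈ range m, 1 / ((m : ℝ) - i)) -
          1 / ((m : ℝ) + 1 + d) * (∑ i ∈ range m, 1 / ((i : ℝ) + 1 + d) +
            ∑ i ∈ range m, 1 / ((m : ℝ) - i))) := by
    simp only [← Finset.sum_add_distrib, Finset.mul_sum, ← Finset.sum_sub_distrib]
    apply Finset.sum_congr rfl
    intro i hi
    have h1 := cast_sub_ne hi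
    have h2 : (i : ℝ) + 1 + d ≠ 0 := by positivity
    have h3 : (i : ℝ) + 1 ≠ 0 := by positivity
    have h4 : (m : ℝ) + 1 + d ≠ 0 := by positivity
    have h5 : (m : ℝ) + 1 ≠ 0 := by positivity
    have h6 : (d : ℝ) ≠ 0 := by positivity
    rw [F_shift F hF, hF]
    field_simp
    ring
  rw [conv_succ (fun i => F i * F (i + d)), e, sum_inv_shift F hF, sum_inv_refl F hF,
    sum_inv F hF, zero_add]
  ring

lemma S2_succ (F : ℕ → ℝ) (hF : ∀ n : ℕ, F (n + 1) = F n + 1 / ((n : ℝ) + 1)) (m d : ℕ) :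
    ∑ i ∈ range (m + 1), F (i + d) ^ 2 / (((m + 1 : ℕ) : ℝ) - i) =
      ∑ i ∈ range m, F (i + d) ^ 2 / ((m : ℝ) - i) +
      (1 / ((m : ℝ) + 1 + d) * (F (m + d) ^ 2 - F d ^ 2 +
          2 * ∑ i ∈ range m, F (i + d) / ((m : ℝ) - i)) +
        1 / ((m : ℝ) + 1 + d) ^ 2 * ((F (m + d) - F d) + (F m - F 0))) +
      F d ^ 2 / ((m : ℝ) + 1) := by
  have t : F (m + d) ^ 2 - F d ^ 2 = ∑ i ∈ range m, (F (i + 1 + d) ^ 2 - F (i + d) ^ 2) := by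
    rw [Finset.sum_range_sub (fun i => F (i + d) ^ 2), zero_add]
  have e : ∑ i ∈ range m, (F (i + 1 + d) ^ 2 - F (i + d) ^ 2) / ((m : ℝ) - i) =
      1 / ((m : ℝ) + 1 + d) * (∑ i ∈ range m, (F (i + 1 + d) ^ 2 - F (i + d) ^ 2) +
          2 * ∑ i ∈ range m, F (i + d) / ((m : ℝ) - i)) +
        1 / ((m : ℝ) + 1 + d) ^ 2 * (∑ i ∈ range m, 1 / ((i : ℝ) + 1 + d) +
          ∑ i ∈ range m, 1 / ((m : ℝ) - i)) := by
    simp only [Finset.mul_sum, ← Finset.sum_add_distrib]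
    apply Finset.sum_congr rfl
    intro i hi
    have h1 := cast_sub_ne hi
    have h2 : (i : ℝ) + 1 + d ≠ 0 := by positivity
    have h4 : (m : ℝ) + 1 + d ≠ 0 := by positivity
    rw [F_shift F hF]
    field_simp
    ring
  rw [conv_succ (fun i => F (i + d) ^ 2), e, ← t, sum_inv_shift F hF, sum_inv_refl F hF,
    zero_add]

lemma main_aux_s13 (F G K : ℕ → ℝ) (hF : ∀ n : ℕ, F (n + 1) = F n + 1 / ((n : ℝ) + 1))
    (hG : ∀ n : ℕ, G (n + 1) = G n - 1 / ((n : ℝ) + 1) ^ 2)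
    (hK : ∀ n : ℕ, K (n + 1) = K n + 2 / ((n : ℝ) + 1) ^ 3) (m d : ℕ) (hd : 0 < d) :
    ∑ i ∈ range m, F i * F (i + d) / ((m : ℝ) - i) =
      (1 / 2) * (∑ i ∈ range m, F (i + d) ^ 2 / ((m : ℝ) - i) +
          ∑ i ∈ range m, F (i + d) ^ 2 / ((i : ℝ) + 1) +
          ∑ i ∈ range m, F i ^ 2 / ((i : ℝ) + 1 + d) +
          ∑ i ∈ range m, G i / ((i : ℝ) + 1 + d)) +
        (1 / (d : ℝ)) * ∑ i ∈ range m, F (i + d) / ((i : ℝ) + 1) +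
        (1 / (2 * (d : ℝ) ^ 2)) * (F d - F (m + d) + F m - F 0) +
        (1 / (2 * (d : ℝ))) * (F d ^ 2 - F (m + d) ^ 2) +
        (1 / 12) * (6 * F (m + d) ^ 2 * (F d + F 0) +
          6 * F (m + d) * (-2 * F m * (F d + F 0) +
            G d - G (m + d) + F m ^ 2 + G m - 2 * G 0) -
          2 * F d ^ 3 + 6 * F 0 * F d ^ 2 +
          6 * F m * (G (m + d) - G d) +
          6 * (F m ^ 2 + G m) * F d +
          K d - 4 * F (m + d) ^ 3 - K (m + d)) := by
  induction m with
  | zero => simp; ring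
  | succ m ih =>
    rw [S1_succ F hF m d hd, S2_succ F hF, ih]
    simp only [Finset.sum_range_succ (fun i => F (i + d) ^ 2 / ((i : ℝ) + 1)),
      Finset.sum_range_succ (fun i => F i ^ 2 / ((i : ℝ) + 1 + d)),
      Finset.sum_range_succ (fun i => G i / ((i : ℝ) + 1 + d)),
      Finset.sum_range_succ (fun i => F (i + d) / ((i : ℝ) + 1))]
    rw [T4_closed F G hF hG, T2_closed F G hF hG, T13 F hF m d hd, F_shift F hF, G_shift G hG,
      K_shift K hK, hF, hG]
    generalize ∑ i ∈ range m, F (i + d) ^ 2 / ((m : ℝ) - i) = X1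
    generalize ∑ i ∈ range m, F (i + d) ^ 2 / ((i : ℝ) + 1) = X2
    generalize ∑ i ∈ range m, F i ^ 2 / ((i : ℝ) + 1 + d) = X3
    generalize ∑ i ∈ range m, G i / ((i : ℝ) + 1 + d) = X4
    generalize ∑ i ∈ range m, F i / ((i : ℝ) + 1 + d) = X5
    generalize F (m + d) = A
    generalize F m = B
    generalize F d = C
    generalize F 0 = D
    generalize G (m + d) = A1
    generalize G m = B1
    generalize G d = C1
    generalize G 0 = D1
    generalize K (m + d) = A2
    generalize K d = C2
    have h4 : (m : ℝ) + 1 + d ≠ 0 := by positivity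
    have h5 : (m : ℝ) + 1 ≠ 0 := by positivity
    have h6 : (d : ℝ) ≠ 0 := by positivity
    field_simp
    ring

theorem stmt13 (m a : ℕ) (hm : 0 < m) (ha : m < a) :
    ∑ k ∈ Finset.Icc 1 m, ψ₀ k * ψ₀ (k + a - m) / ((m + 1 - k : ℕ) : ℝ) =
      (1 / 2) * ∑ k ∈ Finset.Icc 1 m,
          (ψ₀ (a + 1 - k) ^ 2 / (k : ℝ) + ψ₀ (k + a - m) ^ 2 / (k : ℝ) +
            ψ₀ k ^ 2 / ((k + a - m : ℕ) : ℝ) + ψ₁ k / ((k + a - m : ℕ) : ℝ)) +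
        (1 / ((a : ℝ) - m)) * ∑ k ∈ Finset.Icc 1 m, ψ₀ (k + a - m) / (k : ℝ) +
        (1 / (2 * ((a : ℝ) - m) ^ 2)) *
          (ψ₀ (a - m + 1) - ψ₀ (a + 1) + ψ₀ (m + 1) - ψ₀ 1) +
        (1 / (2 * ((a : ℝ) - m))) * (ψ₀ (a - m + 1) ^ 2 - ψ₀ (a + 1) ^ 2) +
        (1 / 12) * (6 * ψ₀ (a + 1) ^ 2 * (ψ₀ (a - m + 1) + ψ₀ 1) +
          6 * ψ₀ (a + 1) * (-2 * ψ₀ (m + 1) * (ψ₀ (a - m + 1) + ψ₀ 1) +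
            ψ₁ (a - m + 1) - ψ₁ (a + 1) + ψ₀ (m + 1) ^ 2 + ψ₁ (m + 1) - 2 * ψ₁ 1) -
          2 * ψ₀ (a - m + 1) ^ 3 + 6 * ψ₀ 1 * ψ₀ (a - m + 1) ^ 2 +
          6 * ψ₀ (m + 1) * (ψ₁ (a + 1) - ψ₁ (a - m + 1)) +
          6 * (ψ₀ (m + 1) ^ 2 + ψ₁ (m + 1)) * ψ₀ (a - m + 1) +
          ψ₂ (a - m + 1) - 4 * ψ₀ (a + 1) ^ 3 - ψ₂ (a + 1)) := by
  obtain ⟨d, rfl⟩ : ∃ d, a = m + d := ⟨a - m, by omega⟩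
  have hd : 0 < d := by omega
  have hF : ∀ n : ℕ, ψ₀ (n + 1 + 1) = ψ₀ (n + 1) + 1 / ((n : ℝ) + 1) := by
    intro n
    simp only [ψ₀, Nat.add_sub_cancel, Finset.sum_range_succ]
    ring
  have hG : ∀ n : ℕ, ψ₁ (n + 1 + 1) = ψ₁ (n + 1) - 1 / ((n : ℝ) + 1) ^ 2 := by
    intro n
    simp only [ψ₁, Nat.add_sub_cancel, Finset.sum_range_succ]
    ring
  have hK : ∀ n : ℕ, ψ₂ (n + 1 + 1) = ψ₂ (n + 1) + 2 / ((n : ℝ) + 1) ^ 3 := by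
    intro n
    simp only [ψ₂, Nat.add_sub_cancel, Finset.sum_range_succ]
    ring
  have key := main_aux_s13 (fun n => ψ₀ (n + 1)) (fun n => ψ₁ (n + 1)) (fun n => ψ₂ (n + 1))
    hF hG hK m d hd
  have icc : ∀ f : ℕ → ℝ, ∑ k ∈ Finset.Icc 1 m, f k = ∑ i ∈ range m, f (i + 1) := by
    intro f
    rw [← Finset.Ico_add_one_right_eq_Icc, Finset.sum_Ico_eq_sum_range]
    simp [add_comm]
  have hidx : ∀ i : ℕ, i + 1 + (m + d) - m = i + d + 1 := by intro i; omega
  have e1 : ∑ k ∈ Finset.Icc 1 m, ψ₀ k * ψ₀ (k + (m + d) - m) / ((m + 1 - k : ℕ) : ℝ) =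
      ∑ i ∈ range m, ψ₀ (i + 1) * ψ₀ (i + d + 1) / ((m : ℝ) - i) := by
    rw [icc]
    apply Finset.sum_congr rfl
    intro i hi
    have := Finset.mem_range.mp hi
    rw [hidx, Nat.add_sub_add_right, Nat.cast_sub this.le]
  have e2 : ∑ k ∈ Finset.Icc 1 m, ψ₀ (m + d + 1 - k) ^ 2 / (k : ℝ) =
      ∑ i ∈ range m, ψ₀ (i + d + 1) ^ 2 / ((m : ℝ) - i) := by
    rw [icc, ← Finset.sum_range_reflect]
    apply Finset.sum_congr rfl
    intro i hi
    have := Finset.mem_range.mp hi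
    rw [show m + d + 1 - (m - 1 - i + 1) = i + d + 1 by omega,
      show m - 1 - i + 1 = m - i by omega, Nat.cast_sub this.le]
  have e3 : ∑ k ∈ Finset.Icc 1 m, ψ₀ (k + (m + d) - m) ^ 2 / (k : ℝ) =
      ∑ i ∈ range m, ψ₀ (i + d + 1) ^ 2 / ((i : ℝ) + 1) := by
    rw [icc]
    simp only [hidx]
    push_cast
    rfl
  have hc : ∀ i : ℕ, ((i + d + 1 : ℕ) : ℝ) = (i : ℝ) + 1 + d := by
    intro i; push_cast; ring
  have e4 : ∑ k ∈ Finset.Icc 1 m, ψ₀ k ^ 2 / ((k + (m + d) - m : ℕ) : ℝ) =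
      ∑ i ∈ range m, ψ₀ (i + 1) ^ 2 / ((i : ℝ) + 1 + d) := by
    rw [icc]
    simp only [hidx, hc]
  have e5 : ∑ k ∈ Finset.Icc 1 m, ψ₁ k / ((k + (m + d) - m : ℕ) : ℝ) =
      ∑ i ∈ range m, ψ₁ (i + 1) / ((i : ℝ) + 1 + d) := by
    rw [icc]
    simp only [hidx, hc]
  have e6 : ∑ k ∈ Finset.Icc 1 m, ψ₀ (k + (m + d) - m) / (k : ℝ) =
      ∑ i ∈ range m, ψ₀ (i + d + 1) / ((i : ℝ) + 1) := by
    rw [icc]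
    simp only [hidx]
    push_cast
    rfl
  rw [Finset.sum_add_distrib, Finset.sum_add_distrib, Finset.sum_add_distrib, e1, e2, e3, e4,
    e5, e6, show m + d - m = d by omega, show ((m + d : ℕ) : ℝ) - m = d by push_cast; ring]
  exact key
end

section
/- Let m be a positive integer and let a, b, c be three distinct positive integers. Then ∑_{k=1}^{m} ( ψ₀(k+b)ψ₀(k+c)/(k+a) + ψ₀(k+a)ψ₀(k+c)/(k+b) + ψ₀(k+a)ψ₀(k+b)/(k+c) ) = (1/(b-a) + ψ₀(a))·∑_{k=1}^{m} ψ₀(k+c)/(k+b) + (1/(c-a) + ψ₀(a))·∑_{k=1}^{m} ψ₀(k+b)/(k+c) + (1/(a-b) + ψ₀(b))·∑_{k=1}^{m} ψ₀(k+c)/(k+a) + (1/(c-b) + ψ₀(b))·∑_{k=1}^{m} ψ₀(k+a)/(k+c) + (1/(a-c) + ψ₀(c+m))·∑_{k=1}^{m} ψ₀(k+b)/(k+a) + (1/(b-c) + ψ₀(c+m))·∑_{k=1}^{m} ψ₀(k+a)/(k+b) + (1/(c-b) - 1/(c+m))·ψ₀(a)·ψ₀(b+m) + (1/(c-a) - 1/(c+m))·ψ₀(a+m)·ψ₀(b)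 + ψ₀(a)·ψ₀(b)·ψ₀(c+m) - ψ₀(a)·ψ₀(b+m)·ψ₀(c+m) + ψ₀(a)·ψ₀(b)·ψ₀(c) - ψ₀(b)·ψ₀(a+m)·ψ₀(c+m) + [(a+m)(a-b-c-m)/((a-b)(a-c)(b+m)(c+m))]·ψ₀(a+m) + (1/(b-a))·ψ₀(a+m)·ψ₀(c+m) + [(b+m)(a-b+c+m)/((a-b)(a+m)(b-c)(c+m))]·ψ₀(b+m) + (1/(a-b))·ψ₀(b+m)·ψ₀(c+m) + [(c+m)(a+b-c+m)/((a-c)(a+m)(c-b)(b+m))]·ψ₀(c+m) + (1/(c+m))·ψ₀(a+m)·ψ₀(b+m) + (1/(a-c) + 1/(b-c) + 1/c)·ψ₀(a)·ψ₀(b) + (1/(b-a) + 1/(a-c) - 1/(a+m) + 1/a)·ψ₀(b)·ψ₀(c+m) + (1/(c-b))·ψ₀(a)·ψ₀(c) + (1/(a-b) + 1/(b-c) - 1/(b+m) + 1/b)·ψ₀(a)·ψ₀(c+m) + (1/(c-a))·ψ₀(b)·ψ₀(c) + [a(-a+b+c)/(bc(a-b)(a-c))]·ψ₀(a) - [b(a-b+c)/(ac(a-b)(b-c))]·ψ₀(b)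 + [c(a+b-c)/(ab(a-c)(b-c))]·ψ₀(c). -/
open Finset

lemma psi_succ (l : ℕ) (h : 0 < l) : ψ₀ (l + 1) = ψ₀ l + 1 / (l : ℝ) := by
  obtain ⟨n, rfl⟩ : ∃ n, l = n + 1 := ⟨l - 1, by omega⟩
  simp only [ψ₀, Nat.add_sub_cancel, Finset.sum_range_succ]
  push_cast
  ring

lemma psi_k (k a : ℕ) (h : 0 < a) : ψ₀ (k + 1 + a) = ψ₀ (k + a) + 1 / ((k : ℝ) + a) := by
  have := psi_succ (k + a) (by omega)
  rw [show k + 1 + a = k + a + 1 by ring, this]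
  push_cast
  ring

lemma tele (f : ℕ → ℝ) (m : ℕ) :
    ∑ k ∈ Finset.Icc 1 m, (f (k + 1) - f k) = f (m + 1) - f 1 := by
  induction m with
  | zero => simp
  | succ n ih => rw [Finset.sum_Icc_succ_top (by omega), ih]; ring

lemma psi_end (m a : ℕ) (h : 0 < a) : ψ₀ (m + 1 + a) = ψ₀ (a + m) + 1 / ((a : ℝ) + m) := by
  rw [psi_k m a h, add_comm m a, add_comm (m : ℝ)]

lemma psi_start (a : ℕ) (h : 0 < a) : ψ₀ (1 + a) = ψ₀ a + 1 / (a : ℝ) := by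
  rw [add_comm, psi_succ a h]

lemma sum_one (m a : ℕ) (h : 0 < a) :
    ∑ k ∈ Finset.Icc 1 m, 1 / ((k : ℝ) + a) =
      (ψ₀ (a + m) + 1 / ((a : ℝ) + m)) - (ψ₀ a + 1 / (a : ℝ)) := by
  have := tele (fun k => ψ₀ (k + a)) m
  rw [psi_end m a h, psi_start a h] at this
  rw [← this]
  refine Finset.sum_congr rfl fun k _ => ?_
  rw [psi_k k a h]; ring

lemma sum_two (m a b : ℕ) (ha : 0 < a) (hb : 0 < b) (hab : a ≠ b) :
    ∑ k ∈ Finset.Icc 1 m, ψ₀ (k + b) / ((k : ℝ) + a) +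
      ∑ k ∈ Finset.Icc 1 m, ψ₀ (k + a) / ((k : ℝ) + b) =
    (ψ₀ (a + m) + 1 / ((a : ℝ) + m)) * (ψ₀ (b + m) + 1 / ((b : ℝ) + m)) -
      (ψ₀ a + 1 / (a : ℝ)) * (ψ₀ b + 1 / (b : ℝ)) -
      (((ψ₀ (a + m) + 1 / ((a : ℝ) + m)) - (ψ₀ a + 1 / (a : ℝ))) -
       ((ψ₀ (b + m) + 1 / ((b : ℝ) + m)) - (ψ₀ b + 1 / (b : ℝ)))) * (1 / ((b : ℝ) - a)) := by
  have := tele (fun k => ψ₀ (k + a) * ψ₀ (k + b)) m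
  rw [psi_end m a ha, psi_start a ha, psi_end m b hb, psi_start b hb] at this
  rw [← this, ← sum_one m a ha, ← sum_one m b hb, ← Finset.sum_sub_distrib, Finset.sum_mul,
    ← Finset.sum_sub_distrib, ← Finset.sum_add_distrib]
  refine Finset.sum_congr rfl fun k _ => ?_
  rw [psi_k k a ha, psi_k k b hb]
  have h1 : (k : ℝ) + a ≠ 0 := by positivity
  have h2 : (k : ℝ) + b ≠ 0 := by positivity
  have h3 : (b : ℝ) - a ≠ 0 := sub_ne_zero.mpr (by exact_mod_cast hab.symm)
  field_simp
  ring

lemma sum_three (m a b c : ℕ) (ha : 0 < a) (hb : 0 < b) (hc : 0 < c)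
    (hab : a ≠ b) (hac : a ≠ c) (hbc : b ≠ c) :
    ∑ k ∈ Finset.Icc 1 m, (ψ₀ (k + b) * ψ₀ (k + c) / ((k : ℝ) + a) +
        ψ₀ (k + a) * ψ₀ (k + c) / ((k : ℝ) + b) +
        ψ₀ (k + a) * ψ₀ (k + b) / ((k : ℝ) + c)) =
    (ψ₀ (a + m) + 1 / ((a : ℝ) + m)) * (ψ₀ (b + m) + 1 / ((b : ℝ) + m)) *
        (ψ₀ (c + m) + 1 / ((c : ℝ) + m)) -
      (ψ₀ a + 1 / (a : ℝ)) * (ψ₀ b + 1 / (b : ℝ)) * (ψ₀ c + 1 / (c : ℝ)) -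
      (∑ k ∈ Finset.Icc 1 m, ψ₀ (k + a) / ((k : ℝ) + b) -
        ∑ k ∈ Finset.Icc 1 m, ψ₀ (k + a) / ((k : ℝ) + c)) * (1 / ((c : ℝ) - b)) -
      (∑ k ∈ Finset.Icc 1 m, ψ₀ (k + b) / ((k : ℝ) + a) -
        ∑ k ∈ Finset.Icc 1 m, ψ₀ (k + b) / ((k : ℝ) + c)) * (1 / ((c : ℝ) - a)) -
      (∑ k ∈ Finset.Icc 1 m, ψ₀ (k + c) / ((k : ℝ) + a) -
        ∑ k ∈ Finset.Icc 1 m, ψ₀ (k + c) / ((k : ℝ) + b)) * (1 / ((b : ℝ) - a)) -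
      ((ψ₀ (a + m) + 1 / ((a : ℝ) + m)) - (ψ₀ a + 1 / (a : ℝ))) *
        (1 / (((b : ℝ) - a) * ((c : ℝ) - a))) -
      ((ψ₀ (b + m) + 1 / ((b : ℝ) + m)) - (ψ₀ b + 1 / (b : ℝ))) *
        (1 / (((a : ℝ) - b) * ((c : ℝ) - b))) -
      ((ψ₀ (c + m) + 1 / ((c : ℝ) + m)) - (ψ₀ c + 1 / (c : ℝ))) *
        (1 / (((a : ℝ) - c) * ((b : ℝ) - c))) := by
  have := tele (fun k => ψ₀ (k + a) * ψ₀ (k + b) * ψ₀ (k + c)) m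
  rw [psi_end m a ha, psi_start a ha, psi_end m b hb, psi_start b hb,
    psi_end m c hc, psi_start c hc] at this
  rw [← this, ← sum_one m a ha, ← sum_one m b hb, ← sum_one m c hc]
  simp only [← Finset.sum_sub_distrib, Finset.sum_mul]
  refine Finset.sum_congr rfl fun k _ => ?_
  rw [psi_k k a ha, psi_k k b hb, psi_k k c hc]
  have h1 : (k : ℝ) + a ≠ 0 := by positivity
  have h2 : (k : ℝ) + b ≠ 0 := by positivity
  have h2' : (k : ℝ) + c ≠ 0 := by positivity
  have h3 : (b : ℝ) - a ≠ 0 := sub_ne_zero.mpr (by exact_mod_cast hab.symm)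
  have h4 : (c : ℝ) - a ≠ 0 := sub_ne_zero.mpr (by exact_mod_cast hac.symm)
  have h5 : (c : ℝ) - b ≠ 0 := sub_ne_zero.mpr (by exact_mod_cast hbc.symm)
  rw [show (a : ℝ) - b = -(b - a) by ring, show (a : ℝ) - c = -(c - a) by ring,
    show (b : ℝ) - c = -(c - b) by ring]
  field_simp
  ring

set_option maxHeartbeats 4000000 in
theorem stmt16 (m a b c : ℕ) (hm : 0 < m) (ha : 0 < a) (hb : 0 < b) (hc : 0 < c)
    (hab : a ≠ b) (hac : a ≠ c) (hbc : b ≠ c) :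
    ∑ k ∈ Finset.Icc 1 m, (ψ₀ (k + b) * ψ₀ (k + c) / ((k : ℝ) + a) +
        ψ₀ (k + a) * ψ₀ (k + c) / ((k : ℝ) + b) +
        ψ₀ (k + a) * ψ₀ (k + b) / ((k : ℝ) + c)) =
      (1 / ((b : ℝ) - a) + ψ₀ a) * ∑ k ∈ Finset.Icc 1 m, ψ₀ (k + c) / ((k : ℝ) + b) +
      (1 / ((c : ℝ) - a) + ψ₀ a) * ∑ k ∈ Finset.Icc 1 m, ψ₀ (k + b) / ((k : ℝ) + c) +
      (1 / ((a : ℝ) - b) + ψ₀ b) * ∑ k ∈ Finset.Icc 1 m, ψ₀ (k + c) / ((k : ℝ) + a) +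
      (1 / ((c : ℝ) - b) + ψ₀ b) * ∑ k ∈ Finset.Icc 1 m, ψ₀ (k + a) / ((k : ℝ) + c) +
      (1 / ((a : ℝ) - c) + ψ₀ (c + m)) *
        ∑ k ∈ Finset.Icc 1 m, ψ₀ (k + b) / ((k : ℝ) + a) +
      (1 / ((b : ℝ) - c) + ψ₀ (c + m)) *
        ∑ k ∈ Finset.Icc 1 m, ψ₀ (k + a) / ((k : ℝ) + b) +
      (1 / ((c : ℝ) - b) - 1 / ((c : ℝ) + m)) * ψ₀ a * ψ₀ (b + m) +
      (1 / ((c : ℝ) - a) - 1 / ((c : ℝ) + m)) * ψ₀ (a + m) * ψ₀ b +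
      ψ₀ a * ψ₀ b * ψ₀ (c + m) - ψ₀ a * ψ₀ (b + m) * ψ₀ (c + m) +
      ψ₀ a * ψ₀ b * ψ₀ c - ψ₀ b * ψ₀ (a + m) * ψ₀ (c + m) +
      (((a : ℝ) + m) * ((a : ℝ) - b - c - m) /
          (((a : ℝ) - b) * ((a : ℝ) - c) * ((b : ℝ) + m) * ((c : ℝ) + m))) * ψ₀ (a + m) +
      (1 / ((b : ℝ) - a)) * ψ₀ (a + m) * ψ₀ (c + m) +
      (((b : ℝ) + m) * ((a : ℝ) - b + c + m) /
          (((a : ℝ) - b) * ((a : ℝ) + m) * ((b : ℝ) - c) * ((c : ℝ) + m))) * ψ₀ (b + m) +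
      (1 / ((a : ℝ) - b)) * ψ₀ (b + m) * ψ₀ (c + m) +
      (((c : ℝ) + m) * ((a : ℝ) + b - c + m) /
          (((a : ℝ) - c) * ((a : ℝ) + m) * ((c : ℝ) - b) * ((b : ℝ) + m))) * ψ₀ (c + m) +
      (1 / ((c : ℝ) + m)) * ψ₀ (a + m) * ψ₀ (b + m) +
      (1 / ((a : ℝ) - c) + 1 / ((b : ℝ) - c) + 1 / (c : ℝ)) * ψ₀ a * ψ₀ b +
      (1 / ((b : ℝ) - a) + 1 / ((a : ℝ) - c) - 1 / ((a : ℝ) + m) + 1 / (a : ℝ)) *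
        ψ₀ b * ψ₀ (c + m) +
      (1 / ((c : ℝ) - b)) * ψ₀ a * ψ₀ c +
      (1 / ((a : ℝ) - b) + 1 / ((b : ℝ) - c) - 1 / ((b : ℝ) + m) + 1 / (b : ℝ)) *
        ψ₀ a * ψ₀ (c + m) +
      (1 / ((c : ℝ) - a)) * ψ₀ b * ψ₀ c +
      ((a : ℝ) * (-(a : ℝ) + b + c) /
          ((b : ℝ) * c * ((a : ℝ) - b) * ((a : ℝ) - c))) * ψ₀ a -
      ((b : ℝ) * ((a : ℝ) - b + c) /
          ((a : ℝ) * c * ((a : ℝ) - b) * ((b : ℝ) - c))) * ψ₀ b +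
      ((c : ℝ) * ((a : ℝ) + b - c) /
          ((a : ℝ) * b * ((a : ℝ) - c) * ((b : ℝ) - c))) * ψ₀ c := by
  rw [sum_three m a b c ha hb hc hab hac hbc]
  have e1 := sum_two m a b ha hb hab
  have e2 := sum_two m a c ha hc hac
  have e3 := sum_two m b c hb hc hbc
  have n1 : (a : ℝ) + m ≠ 0 := by positivity
  have n2 : (b : ℝ) + m ≠ 0 := by positivity
  have n3 : (c : ℝ) + m ≠ 0 := by positivity
  have n4 : (a : ℝ) ≠ 0 := by positivity
  have n5 : (b : ℝ) ≠ 0 := by positivity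
  have n6 : (c : ℝ) ≠ 0 := by positivity
  have h3 : (b : ℝ) - a ≠ 0 := sub_ne_zero.mpr (by exact_mod_cast hab.symm)
  have h4 : (c : ℝ) - a ≠ 0 := sub_ne_zero.mpr (by exact_mod_cast hac.symm)
  have h5 : (c : ℝ) - b ≠ 0 := sub_ne_zero.mpr (by exact_mod_cast hbc.symm)
  rw [show (a : ℝ) - b = -(b - a) by ring, show (a : ℝ) - c = -(c - a) by ring,
    show (b : ℝ) - c = -(c - b) by ring]
  generalize (∑ k ∈ Finset.Icc 1 m, ψ₀ (k + b) / ((k : ℝ) + a)) = Sba at *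
  generalize (∑ k ∈ Finset.Icc 1 m, ψ₀ (k + a) / ((k : ℝ) + b)) = Sab at *
  generalize (∑ k ∈ Finset.Icc 1 m, ψ₀ (k + c) / ((k : ℝ) + a)) = Sca at *
  generalize (∑ k ∈ Finset.Icc 1 m, ψ₀ (k + a) / ((k : ℝ) + c)) = Sac at *
  generalize (∑ k ∈ Finset.Icc 1 m, ψ₀ (k + c) / ((k : ℝ) + b)) = Scb at *
  generalize (∑ k ∈ Finset.Icc 1 m, ψ₀ (k + b) / ((k : ℝ) + c)) = Sbc at *
  generalize ψ₀ (a + m) = Am at *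
  generalize ψ₀ (b + m) = Bm at *
  generalize ψ₀ (c + m) = Cm at *
  generalize ψ₀ a = A at *
  generalize ψ₀ b = B at *
  generalize ψ₀ c = C at *
  generalize (a : ℝ) = x at *
  generalize (b : ℝ) = y at *
  generalize (c : ℝ) = z at *
  generalize (m : ℝ) = t at *
  obtain rfl : Sba = _ := eq_sub_of_add_eq e1
  obtain rfl : Sca = _ := eq_sub_of_add_eq e2
  obtain rfl : Scb = _ := eq_sub_of_add_eq e3
  clear e1 e2 e3
  field_simp
  ring
end
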